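/- Theorem 3.4 (perturbed left-hand side and right-hand side). Let n, k be positive integers, A ∈ ℝ^{n×n}, x⁰, …, x^k ∈ ℝⁿ, r^k ∈ ℝⁿ, δr^k ∈ ℝⁿ, and E_1, …, E_k ∈ ℝ^{n×n}. Let R_k ∈ ℝ^{n×k} be arbitrary, let ℰ_k ∈ ℝ^{n×k} be the matrix whose i-th column is E_i A (x^i − x^{i−1}), and set R̂_k = R_k + ℰ_k. Suppose R̂_k has a QR factorization R̂_k = Q̂T̂ with Q̂ᵀQ̂ = I_k and T̂ invertible, and let ĝ ∈ ℝ^k be a least-squares solution of min_g ‖R̂_k g − (r^k + δr^k)‖₂. Let ε > 0 and assume ‖δr^k‖₂ ≤ ε ‖r^k‖₂. If for every i = 1, …, k the bound k · (1 + ε) · ‖T̂⁻¹‖₂ · ‖E_i‖₂ · ‖r^k‖₂ · ‖x^i − x^{i−1}‖₂ ≤ ε holds, then δ_k := ‖ℰ_k ĝ‖₂ ≤ ε · max(‖A‖₂, ‖r^k‖₂). -/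

import Mathlib

open Matrix

noncomputable def vnorm {n : ℕ} (v : Fin n → ℝ) : ℝ :=
  ‖(WithLp.equiv 2 (Fin n → ℝ)).symm v‖

noncomputable def mnorm {m n : ℕ} (M : Matrix (Fin m) (Fin n) ℝ) : ℝ :=
  ‖LinearMap.toContinuousLinearMap (Matrix.toEuclideanLin M)‖

def IsLSSol {n k : ℕ} (M : Matrix (Fin n) (Fin k) ℝ) (r : Fin n → ℝ)
    (g : Fin k → ℝ) : Prop :=
  ∀ h : Fin k → ℝ, vnorm (M.mulVec g - r) ≤ vnorm (M.mulVec h - r)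

theorem vnorm_eq {n : ℕ} (v : Fin n → ℝ) : vnorm v = ‖WithLp.toLp 2 v‖ := rfl

theorem vnorm_nonneg {n : ℕ} (v : Fin n → ℝ) : 0 ≤ vnorm v := norm_nonneg _

theorem mnorm_nonneg {m n : ℕ} (M : Matrix (Fin m) (Fin n) ℝ) : 0 ≤ mnorm M := norm_nonneg _

theorem vnorm_sq {n : ℕ} (v : Fin n → ℝ) : vnorm v ^ 2 = v ⬝ᵥ v := by
  rw [vnorm_eq, EuclideanSpace.real_norm_sq_eq]
  simp [dotProduct, pow_two]

theorem vnorm_add_le {n : ℕ} (u v : Fin n → ℝ) : vnorm (u + v) ≤ vnorm u + vnorm v :=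
  norm_add_le (WithLp.toLp 2 u) (WithLp.toLp 2 v)

theorem vnorm_smul {n : ℕ} (a : ℝ) (v : Fin n → ℝ) : vnorm (a • v) = |a| * vnorm v :=
  norm_smul a (WithLp.toLp 2 v)

theorem vnorm_sum_le {n : ℕ} {ι : Type*} (s : Finset ι) (f : ι → Fin n → ℝ) :
    vnorm (∑ i ∈ s, f i) ≤ ∑ i ∈ s, vnorm (f i) := by
  rw [vnorm_eq, WithLp.toLp_sum]
  exact norm_sum_le _ _

theorem abs_apply_le_vnorm {n : ℕ} (v : Fin n → ℝ) (i : Fin n) : |v i| ≤ vnorm v :=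
  PiLp.norm_apply_le (WithLp.toLp 2 v) i

theorem vnorm_mulVec_le {m n : ℕ} (M : Matrix (Fin m) (Fin n) ℝ) (v : Fin n → ℝ) :
    vnorm (M *ᵥ v) ≤ mnorm M * vnorm v :=
  (LinearMap.toContinuousLinearMap (Matrix.toEuclideanLin M)).le_opNorm (WithLp.toLp 2 v)

theorem vnorm_mulVec_of_transpose_mul_self {m n : ℕ} {Q : Matrix (Fin m) (Fin n) ℝ}
    (hQ : Qᵀ * Q = 1) (v : Fin n → ℝ) : vnorm (Q *ᵥ v) = vnorm v := by
  rw [← sq_eq_sq₀ (vnorm_nonneg _) (vnorm_nonneg _), vnorm_sq, vnorm_sq, dotProduct_mulVec,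
    ← mulVec_transpose, mulVec_mulVec, hQ, one_mulVec]

theorem norm_le_of_norm_sub_le_norm_smul_sub {V : Type*} [NormedAddCommGroup V]
    [InnerProductSpace ℝ V] {w c : V} (h : ∀ t : ℝ, ‖w - c‖ ≤ ‖t • w - c‖) : ‖w‖ ≤ ‖c‖ := by
  rcases eq_or_ne w 0 with rfl | hw
  · simp
  have hw' : 0 < ‖w‖ := norm_pos_iff.mpr hw
  have h1 := pow_le_pow_left₀ (norm_nonneg _) (h (inner ℝ w c / ‖w‖ ^ 2)) 2
  rw [norm_sub_sq_real, norm_sub_sq_real, norm_smul, real_inner_smul_left, mul_pow,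
    Real.norm_eq_abs, sq_abs] at h1
  have h2 : (inner ℝ w c / ‖w‖ ^ 2) ^ 2 * ‖w‖ ^ 2 -
      2 * (inner ℝ w c / ‖w‖ ^ 2 * inner ℝ w c) = -(inner ℝ w c) ^ 2 / ‖w‖ ^ 2 := by
    field_simp
    ring
  have h3 : ‖w‖ ^ 2 - 2 * inner ℝ w c ≤ -(inner ℝ w c) ^ 2 / ‖w‖ ^ 2 := by linarith
  rw [le_div_iff₀ (by positivity)] at h3
  have h4 : ‖w‖ ^ 2 = inner ℝ w c := by
    have : (‖w‖ ^ 2 - inner ℝ w c) ^ 2 ≤ 0 := by linarith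
    exact sub_eq_zero.mp (pow_eq_zero_iff two_ne_zero |>.mp (le_antisymm this (sq_nonneg _)))
  have h5 := real_inner_le_norm w c
  rw [← h4, pow_two] at h5
  exact le_of_mul_le_mul_left h5 hw'

theorem IsLSSol.vnorm_mulVec_le {n k : ℕ} {M : Matrix (Fin n) (Fin k) ℝ} {r : Fin n → ℝ}
    {g : Fin k → ℝ} (hg : IsLSSol M r g) : vnorm (M *ᵥ g) ≤ vnorm r := by
  refine norm_le_of_norm_sub_le_norm_smul_sub (w := WithLp.toLp 2 (M *ᵥ g))
    (c := WithLp.toLp 2 r) fun t => ?_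
  have := hg (t • g)
  rwa [mulVec_smul] at this

theorem IsLSSol.vnorm_le_of_qr {n k : ℕ} {M Q : Matrix (Fin n) (Fin k) ℝ}
    {T : Matrix (Fin k) (Fin k) ℝ} {r : Fin n → ℝ} {g : Fin k → ℝ} (hg : IsLSSol M r g)
    (hM : M = Q * T) (hQ : Qᵀ * Q = 1) (hT : IsUnit T) : vnorm g ≤ mnorm T⁻¹ * vnorm r := by
  have hTg : vnorm (T *ᵥ g) ≤ vnorm r := by
    rw [← vnorm_mulVec_of_transpose_mul_self hQ, mulVec_mulVec, ← hM]
    exact hg.vnorm_mulVec_le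
  have hgT : g = T⁻¹ *ᵥ (T *ᵥ g) := by
    rw [mulVec_mulVec, nonsing_inv_mul _ ((isUnit_iff_isUnit_det T).mp hT), one_mulVec]
  calc vnorm g = vnorm (T⁻¹ *ᵥ (T *ᵥ g)) := by rw [← hgT]
    _ ≤ mnorm T⁻¹ * vnorm (T *ᵥ g) := _root_.vnorm_mulVec_le _ _
    _ ≤ mnorm T⁻¹ * vnorm r := mul_le_mul_of_nonneg_left hTg (mnorm_nonneg _)

theorem vnorm_mulVec_le_sum_col {n k : ℕ} (M : Matrix (Fin n) (Fin k) ℝ) (g : Fin k → ℝ) :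
    vnorm (M *ᵥ g) ≤ ∑ j, vnorm g * vnorm (fun i => M i j) := by
  have h : M *ᵥ g = ∑ j, g j • (fun i => M i j) := by
    ext i
    simp [mulVec, dotProduct, mul_comm]
  rw [h]
  refine (vnorm_sum_le _ _).trans (Finset.sum_le_sum fun j _ => ?_)
  rw [vnorm_smul]
  exact mul_le_mul_of_nonneg_right (abs_apply_le_vnorm g j) (vnorm_nonneg _)

/-- Theorem 3.4: backward error bound with perturbed left- and right-hand sides. -/
theorem theorem_3_4 {n k : ℕ} (hn : 0 < n) (hk : 0 < k)
    (A : Matrix (Fin n) (Fin n) ℝ) (x : ℕ → Fin n → ℝ) (rk δrk : Fin n → ℝ)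
    (E : Fin k → Matrix (Fin n) (Fin n) ℝ)
    (Rk Ecal : Matrix (Fin n) (Fin k) ℝ)
    (hE : ∀ j : Fin k,
      (fun i => Ecal i j) = (E j).mulVec (A.mulVec (x ((j : ℕ) + 1) - x (j : ℕ))))
    (Rhat : Matrix (Fin n) (Fin k) ℝ) (hRhat : Rhat = Rk + Ecal)
    (Qhat : Matrix (Fin n) (Fin k) ℝ) (That : Matrix (Fin k) (Fin k) ℝ)
    (hQR : Rhat = Qhat * That) (hQ : Qhatᵀ * Qhat = 1) (hT : IsUnit That)
    (ghat : Fin k → ℝ) (hg : IsLSSol Rhat (rk + δrk) ghat)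
    (ε : ℝ) (hε : 0 < ε) (hδr : vnorm δrk ≤ ε * vnorm rk)
    (hbound : ∀ j : Fin k,
      (k : ℝ) * (1 + ε) * mnorm That⁻¹ * mnorm (E j) * vnorm rk *
        vnorm (x ((j : ℕ) + 1) - x (j : ℕ)) ≤ ε) :
    vnorm (Ecal.mulVec ghat) ≤ ε * max (mnorm A) (vnorm rk) := by
  have hr : vnorm (rk + δrk) ≤ (1 + ε) * vnorm rk := by
    linarith [vnorm_add_le rk δrk]
  have hgn : vnorm ghat ≤ mnorm That⁻¹ * ((1 + ε) * vnorm rk) :=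
    (hg.vnorm_le_of_qr hQR hQ hT).trans (mul_le_mul_of_nonneg_left hr (mnorm_nonneg _))
  have hk' : (0 : ℝ) < k := Nat.cast_pos.mpr hk
  have hcol : ∀ j : Fin k,
      vnorm ghat * vnorm (fun i => Ecal i j) ≤ ε * mnorm A / k := by
    intro j
    have hc : vnorm (fun i => Ecal i j) ≤
        mnorm (E j) * (mnorm A * vnorm (x ((j : ℕ) + 1) - x (j : ℕ))) := by
      rw [hE j]
      exact (vnorm_mulVec_le _ _).trans
        (mul_le_mul_of_nonneg_left (vnorm_mulVec_le _ _) (mnorm_nonneg _))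
    have hprod := mul_le_mul hgn hc (vnorm_nonneg _) ((vnorm_nonneg _).trans hgn)
    have hb := mul_le_mul_of_nonneg_right (hbound j) (mnorm_nonneg A)
    rw [le_div_iff₀ hk']
    linarith [mul_le_mul_of_nonneg_right hprod hk'.le]
  calc vnorm (Ecal *ᵥ ghat) ≤ ∑ j, vnorm ghat * vnorm (fun i => Ecal i j) :=
        vnorm_mulVec_le_sum_col _ _
    _ ≤ ∑ _j : Fin k, ε * mnorm A / k := Finset.sum_le_sum fun j _ => hcol j
    _ = ε * mnorm A := by
        rw [Finset.sum_const, Finset.card_univ, Fintype.card_fin, nsmul_eq_mul]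
        field_simp
    _ ≤ ε * max (mnorm A) (vnorm rk) := mul_le_mul_of_nonneg_left (le_max_left _ _) hε.le
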